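/- Reachability implies consistency: if S₀ is an initial configuration and S₀ →* S, then S is consistent with S₀, i.e., Σ_{c ∈ C} M_c(τ_S) ≤ |B_ε(τ_S)|. -/

import Mathlib

open scoped Classical

noncomputable section

/-- A configuration: each bin holds a list of colors (bottom to top) of length at most `h`. -/
def Config {B C : Type*} (h : ℕ) (S : B → List C) : Prop := ∀ b, (S b).length ≤ h

/-- An initial configuration: every bin is full (length `h`) or empty. -/
def InitConfig {B C : Type*} (h : ℕ) (S : B → List C) : Prop :=
  ∀ b, (S b).length = h ∨ (S b).length = 0

/-- A sorted (goal) configuration: every bin is empty or monochromatically full. -/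
def SortedConfig {B C : Type*} (h : ℕ) (S : B → List C) : Prop :=
  ∀ b, S b = [] ∨ ∃ c, S b = List.replicate h c

/-- A ball-move from `S` to `S'`. -/
def BallMove {B C : Type*} (h : ℕ) (S S' : B → List C) : Prop :=
  ∃ b₁ b₂ c, b₁ ≠ b₂ ∧
    S b₁ = S' b₁ ++ [c] ∧
    (S b₂ = [] ∨ (S b₂).getLast? = some c) ∧
    S' b₂ = S b₂ ++ [c] ∧ (S' b₂).length ≤ h ∧
    ∀ b, b ≠ b₁ → b ≠ b₂ → S' b = S b

/-- A water-move from `S` to `S'`. -/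
def WaterMove {B C : Type*} (h : ℕ) (S S' : B → List C) : Prop :=
  ∃ b₁ b₂ c m, 1 ≤ m ∧ b₁ ≠ b₂ ∧
    S b₁ = S' b₁ ++ List.replicate m c ∧
    (S b₂ = [] ∨ (S b₂).getLast? = some c) ∧
    S' b₂ = S b₂ ++ List.replicate m c ∧ (S' b₂).length ≤ h ∧
    ((S' b₁).getLast? ≠ some c ∨ (S' b₂).length = h) ∧
    ∀ b, b ≠ b₁ → b ≠ b₂ → S' b = S b

/-- `i` is a border of the list `α` (1-indexed): `i = 0`, or `1 ≤ i < |α|` and `α[i] ≠ α[i+1]`. -/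
def IsBorder {C : Type*} (α : List C) (i : ℕ) : Prop :=
  i = 0 ∨ (1 ≤ i ∧ i < α.length ∧ α[i-1]? ≠ α[i]?)

/-- The set `D(α)` of borders of `α`. -/
def borders {C : Type*} (α : List C) : Finset ℕ :=
  (Finset.range (α.length + 1)).filter (IsBorder α)

/-- The top border `max D(α)` of a list. -/
def topBorder {C : Type*} (α : List C) : ℕ := (borders α).sup id

/-- The top-border table `τ_S` of a configuration. -/
def tbt {B C : Type*} (S : B → List C) : B → ℕ := fun b => topBorder (S b)

/-- `F_c(τ)`: the number of units of color `c` above the borders of `τ` in `S₀`. -/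
def Fcnt {B C : Type*} [Fintype B] (h : ℕ) (S₀ : B → List C) (τ : B → ℕ) (c : C) : ℕ :=
  ∑ b, ((Finset.Icc (τ b + 1) h).filter (fun i => (S₀ b)[i-1]? = some c)).card

/-- `B_ε(τ)`: the bins whose top border is `0`. -/
def Beps {B : Type*} [Fintype B] (τ : B → ℕ) : Finset B :=
  Finset.univ.filter (fun b => τ b = 0)

/-- `B_c(τ)`: the non-monochrome bins whose top color is `c` (determined from `S₀`). -/
def Bcol {B C : Type*} [Fintype B] (S₀ : B → List C) (τ : B → ℕ) (c : C) : Finset B :=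
  Finset.univ.filter (fun b => τ b ≠ 0 ∧ (S₀ b)[τ b]? = some c)

/-- `G_c(τ) = Σ_{b ∈ B_c(τ)} (h − τ(b))`. -/
def Gcnt {B C : Type*} [Fintype B] (h : ℕ) (S₀ : B → List C) (τ : B → ℕ) (c : C) : ℕ :=
  ∑ b ∈ Bcol S₀ τ c, (h - τ b)

/-- `M_c(τ) = max(0, ⌈(F_c(τ) − G_c(τ))/h⌉)`. -/
def Mcnt {B C : Type*} [Fintype B] (h : ℕ) (S₀ : B → List C) (τ : B → ℕ) (c : C) : ℕ :=
  (⌈((Fcnt h S₀ τ c : ℚ) - (Gcnt h S₀ τ c : ℚ)) / (h : ℚ)⌉).toNat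

/-- `M_c^b(τ) = max(0, ⌈(F_c(τ) − G_c(τ) + (h − τ(b)))/h⌉)`. -/
def McntB {B C : Type*} [Fintype B] (h : ℕ) (S₀ : B → List C) (τ : B → ℕ) (c : C) (b : B) : ℕ :=
  (⌈((Fcnt h S₀ τ c : ℚ) - (Gcnt h S₀ τ c : ℚ) + ((h : ℚ) - (τ b : ℚ))) / (h : ℚ)⌉).toNat

/-- A configuration `S` is consistent with `S₀`. -/
def Consistent {B C : Type*} [Fintype B] [Fintype C] (h : ℕ) (S₀ S : B → List C) : Prop :=
  ∑ c : C, Mcnt h S₀ (tbt S) c ≤ (Beps (tbt S)).card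

/-- `S` is tight (relative to `S₀`): for every color `c` there are exactly `M_c(τ_S)`
nonempty monochrome bins of color `c`. -/
def Tight {B C : Type*} [Fintype B] [Fintype C] (h : ℕ) (S₀ S : B → List C) : Prop :=
  ∀ c : C,
    (Finset.univ.filter (fun b => S b ≠ [] ∧ ∀ x ∈ S b, x = c)).card = Mcnt h S₀ (tbt S) c

/-- The move `τ ↝_b τ'` on top-border tables (relative to `S₀`). -/
def TBMove {B C : Type*} [Fintype B] [Fintype C] (h : ℕ) (S₀ : B → List C)
    (τ τ' : B → ℕ) (b : B) : Prop :=
  (∀ a, a ≠ b → τ a = τ' a) ∧ 0 < τ b ∧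
  τ' b = ((borders (S₀ b)).filter (fun i => i < τ b)).sup id ∧
  ∑ c : C, McntB h S₀ τ c b ≤ (Beps τ).card

/-- The move `τ ↝ τ'`: `τ ↝_b τ'` for some bin `b`. -/
def TBStep {B C : Type*} [Fintype B] [Fintype C] (h : ℕ) (S₀ : B → List C)
    (τ τ' : B → ℕ) : Prop :=
  ∃ b, TBMove h S₀ τ τ' b

end

section WaterSort

variable {B C : Type*}

theorem isBorder_topBorder (α : List C) : IsBorder α (topBorder α) := by
  have hne : (borders α).Nonempty := ⟨0, by simp [borders, IsBorder]⟩
  obtain ⟨i, hi, he⟩ := Finset.exists_mem_eq_sup (borders α) hne id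
  rw [topBorder, he]
  exact (Finset.mem_filter.1 hi).2

theorem IsBorder.le_topBorder {α : List C} {i : ℕ} (hi : IsBorder α i) : i ≤ topBorder α := by
  refine Finset.le_sup (f := id) (Finset.mem_filter.2 ⟨?_, hi⟩)
  rcases hi with rfl | ⟨_, h, _⟩ <;> rw [Finset.mem_range] <;> omega

theorem topBorder_lt_length {α : List C} (hα : topBorder α ≠ 0) : topBorder α < α.length := by
  rcases isBorder_topBorder α with h | h
  · exact absurd h hα
  · exact h.2.1

theorem topBorder_le_length (α : List C) : topBorder α ≤ α.length := by
  by_cases hα : topBorder α = 0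
  · omega
  · exact (topBorder_lt_length hα).le

/-- Above the top border, a list is constant. -/
theorem getElem?_add_topBorder {α : List C} (k : ℕ) (hk : topBorder α + k < α.length) :
    α[topBorder α + k]? = α[topBorder α]? := by
  induction k with
  | zero => rfl
  | succ k ih =>
    rw [← ih (by omega)]
    by_contra hne
    have hb : IsBorder α (topBorder α + (k + 1)) :=
      Or.inr ⟨by omega, hk, fun h => hne (by simpa using h.symm)⟩
    have := hb.le_topBorder
    omega

theorem getElem?_topBorder_of_mem_drop {α : List C} {x : C} (hx : x ∈ α.drop (topBorder α)) :
    α[topBorder α]? = some x := by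
  obtain ⟨k, hk, rfl⟩ := List.mem_iff_getElem.1 hx
  have hk' : topBorder α + k < α.length := by simp at hk; omega
  rw [← getElem?_add_topBorder k hk']
  simp [hk']

theorem IsBorder.append {α : List C} {i : ℕ} (hi : IsBorder α i) (β : List C) :
    IsBorder (α ++ β) i := by
  rcases hi with rfl | ⟨h1, h2, h3⟩
  · exact Or.inl rfl
  · refine Or.inr ⟨h1, by simp; omega, ?_⟩
    rwa [List.getElem?_append_left (by omega), List.getElem?_append_left h2]

theorem topBorder_le_topBorder_append (α β : List C) : topBorder α ≤ topBorder (α ++ β) :=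
  ((isBorder_topBorder α).append β).le_topBorder

theorem topBorder_append_singleton {α : List C} {c : C} (hα : α = [] ∨ α.getLast? = some c) :
    topBorder (α ++ [c]) = topBorder α := by
  refine le_antisymm ?_ (topBorder_le_topBorder_append α [c])
  rcases isBorder_topBorder (α ++ [c]) with h | ⟨h1, h2, h3⟩
  · omega
  · simp only [List.length_append, List.length_singleton] at h2
    have hlt : topBorder (α ++ [c]) < α.length := by
      by_contra hge
      have he : topBorder (α ++ [c]) = α.length := by omega
      rw [he] at h1 h3
      rcases hα with rfl | hl
      · simp at h1
      · rw [List.getLast?_eq_getElem?] at hl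
        rw [List.getElem?_append_left (by omega), hl] at h3
        simp at h3
    rw [List.getElem?_append_left (by omega), List.getElem?_append_left hlt] at h3
    exact IsBorder.le_topBorder (Or.inr ⟨h1, hlt, h3⟩)

theorem card_filter_getElem?_add_count_take (l : List C) (c : C) {t n : ℕ} (htn : t ≤ n) :
    ((Finset.Icc (t + 1) n).filter (fun i => l[i-1]? = some c)).card + (l.take t).count c
      = (l.take n).count c := by
  induction n, htn using Nat.le_induction with
  | base => simp
  | succ n hn ih =>
    rw [← Finset.insert_Icc_right_eq_Icc_add_one (by omega), Finset.filter_insert, List.take_add_one,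
      List.count_append, ← ih]
    cases hl : l[n]? with
    | none => simp [hl]
    | some x =>
      by_cases hx : x = c
      · simp [hl, hx]; omega
      · simp [hl, hx]

variable [Fintype B]

/-- What ball-moves preserve: bins stay within the capacity, color totals do not change, and every
bin with a nonzero top border still agrees with `S₀` up to the first ball above that border. -/
structure ReachInvariant (h : ℕ) (S₀ S : B → List C) : Prop where
  length_le : ∀ b, (S b).length ≤ h
  sum_count : ∀ c, ∑ b, (S b).count c = ∑ b, (S₀ b).count c
  take_eq : ∀ b, tbt S b ≠ 0 → (S b).take (tbt S b + 1) = (S₀ b).take (tbt S b + 1)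

theorem ReachInvariant.refl {h : ℕ} {S₀ : B → List C} (hInit : InitConfig h S₀) :
    ReachInvariant h S₀ S₀ :=
  ⟨fun b => by rcases hInit b with hb | hb <;> omega, fun _ => rfl, fun _ _ => rfl⟩

theorem BallMove.sum_count {h : ℕ} {S S' : B → List C} (hm : BallMove h S S') (c : C) :
    ∑ b, (S' b).count c = ∑ b, (S b).count c := by
  obtain ⟨b₁, b₂, d, hne, h₁, -, h₂, -, hrest⟩ := hm
  have key : ∀ b, (S' b).count c + (if b = b₁ then [d].count c else 0)
      = (S b).count c + (if b = b₂ then [d].count c else 0) := by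
    intro b
    by_cases e₁ : b = b₁
    · subst e₁; simp [h₁, hne]
    · by_cases e₂ : b = b₂
      · subst e₂; simp [h₂, e₁]
      · simp [e₁, e₂, hrest b e₁ e₂]
  have hs := Finset.sum_congr (rfl : (Finset.univ : Finset B) = _) (fun b _ => key b)
  simp only [Finset.sum_add_distrib, Finset.sum_ite_eq', Finset.mem_univ, if_true] at hs
  omega

theorem ReachInvariant.ballMove {h : ℕ} {S₀ S S' : B → List C} (hS : ReachInvariant h S₀ S)
    (hm : BallMove h S S') : ReachInvariant h S₀ S' := by
  refine ⟨?_, fun c => (hm.sum_count c).trans (hS.sum_count c), ?_⟩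
  all_goals
    obtain ⟨b₁, b₂, d, hne, h₁, htop, h₂, hlen, hrest⟩ := hm
    intro b
    have hb := hS.length_le b
    have ht := hS.take_eq b
    by_cases e₁ : b = b₁
    on_goal 2 => by_cases e₂ : b = b₂
  · subst e₁
    rw [h₁, List.length_append] at hb
    omega
  · subst e₂; exact hlen
  · rwa [hrest b e₁ e₂]
  · subst e₁
    intro h0
    simp only [tbt] at h0 ht ⊢
    rw [h₁] at ht
    have hle := topBorder_le_topBorder_append (S' b) [d]
    have hlt := topBorder_lt_length h0
    have := congrArg (List.take (topBorder (S' b) + 1)) (ht (by omega))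
    rwa [List.take_take, List.take_take, Nat.min_eq_left (by omega),
      List.take_append_of_le_length (by omega)] at this
  · subst e₂
    intro h0
    simp only [tbt] at h0 ht ⊢
    rw [h₂, topBorder_append_singleton htop] at h0 ⊢
    have hlt := topBorder_lt_length h0
    rw [List.take_append_of_le_length (by omega)]
    exact ht h0
  · simp only [tbt] at ht ⊢
    rwa [hrest b e₁ e₂]

theorem reachInvariant_of_reflTransGen {h : ℕ} {S₀ S : B → List C} (hInit : InitConfig h S₀)
    (hreach : Relation.ReflTransGen (BallMove h) S₀ S) : ReachInvariant h S₀ S := by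
  induction hreach with
  | refl => exact .refl hInit
  | tail _ hm ih => exact ih.ballMove hm

/-- `Fcnt` counts the balls of color `c` above the top borders of `S`. -/
theorem ReachInvariant.Fcnt_eq {h : ℕ} {S₀ S : B → List C} (hInit : InitConfig h S₀)
    (hS : ReachInvariant h S₀ S) (c : C) :
    Fcnt h S₀ (tbt S) c = ∑ b, ((S b).drop (tbt S b)).count c := by
  have h₀ : Fcnt h S₀ (tbt S) c + ∑ b, ((S₀ b).take (tbt S b)).count c
      = ∑ b, (S₀ b).count c := by
    rw [Fcnt, ← Finset.sum_add_distrib]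
    refine Finset.sum_congr rfl fun b _ => ?_
    have hle : tbt S b ≤ h := (topBorder_le_length (S b)).trans (hS.length_le b)
    rw [card_filter_getElem?_add_count_take _ _ hle, List.take_of_length_le]
    rcases hInit b with hb | hb <;> omega
  have h₁ : ∑ b, ((S b).drop (tbt S b)).count c + ∑ b, ((S₀ b).take (tbt S b)).count c
      = ∑ b, (S b).count c := by
    rw [← Finset.sum_add_distrib]
    refine Finset.sum_congr rfl fun b _ => ?_
    have ht : (S₀ b).take (tbt S b) = (S b).take (tbt S b) := by
      by_cases h0 : tbt S b = 0
      · simp [h0]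
      · have := congrArg (List.take (tbt S b)) (hS.take_eq b h0)
        simpa [List.take_take] using this.symm
    rw [ht, add_comm, ← List.count_append, List.take_append_drop]
  have := hS.sum_count c
  omega

/-- The nonempty monochrome bins of color `c`. -/
noncomputable def monoBins (S : B → List C) (c : C) : Finset B :=
  (Beps (tbt S)).filter (fun b => (S b)[0]? = some c)

theorem ReachInvariant.Fcnt_le {h : ℕ} {S₀ S : B → List C} (hInit : InitConfig h S₀)
    (hS : ReachInvariant h S₀ S) (c : C) :
    Fcnt h S₀ (tbt S) c ≤ Gcnt h S₀ (tbt S) c + h * (monoBins S c).card := by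
  classical
  have hcard : h * (monoBins S c).card = ∑ b, if b ∈ monoBins S c then h else 0 := by
    simp [mul_comm]
  have hG : Gcnt h S₀ (tbt S) c = ∑ b, if b ∈ Bcol S₀ (tbt S) c then h - tbt S b else 0 := by
    simp [Gcnt]
  rw [hS.Fcnt_eq hInit c, hcard, hG, ← Finset.sum_add_distrib]
  refine Finset.sum_le_sum fun b _ => ?_
  by_cases hc : c ∈ (S b).drop (tbt S b)
  · have htop : (S b)[tbt S b]? = some c := getElem?_topBorder_of_mem_drop hc
    have hle : ((S b).drop (tbt S b)).count c ≤ h - tbt S b := by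
      have h₁ := List.count_le_length (a := c) (l := (S b).drop (tbt S b))
      have h₂ := hS.length_le b
      rw [List.length_drop] at h₁
      omega
    by_cases h0 : tbt S b = 0
    · have hmem : b ∈ monoBins S c := by
        rw [h0] at htop
        simp [monoBins, Beps, h0, htop]
      rw [if_pos hmem]
      omega
    · have hmem : b ∈ Bcol S₀ (tbt S) c := by
        have ht := congrArg (fun l => l[tbt S b]?) (hS.take_eq b h0)
        simp only [List.getElem?_take, Nat.lt_succ_self, if_true] at ht
        simp [Bcol, h0, ← ht, htop]
      rw [if_pos hmem]
      omega
  · rw [List.count_eq_zero_of_not_mem hc]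
    exact Nat.zero_le _

theorem Mcnt_le_of_Fcnt_le {h : ℕ} (hh : 1 ≤ h) {S₀ : B → List C} {τ : B → ℕ} {c : C} {n : ℕ}
    (hF : Fcnt h S₀ τ c ≤ Gcnt h S₀ τ c + h * n) : Mcnt h S₀ τ c ≤ n := by
  have hpos : (0 : ℚ) < h := by exact_mod_cast hh
  have hq : (Fcnt h S₀ τ c : ℚ) ≤ Gcnt h S₀ τ c + h * n := by exact_mod_cast hF
  rw [Mcnt, Int.toNat_le, Int.ceil_le, div_le_iff₀ hpos]
  push_cast
  linarith

theorem sum_card_monoBins_le [Fintype C] (S : B → List C) :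
    ∑ c, (monoBins S c).card ≤ (Beps (tbt S)).card := by
  classical
  rw [← Finset.card_biUnion]
  · exact Finset.card_le_card (Finset.biUnion_subset.2 fun c _ => Finset.filter_subset _ _)
  · intro c _ d _ hcd
    refine Finset.disjoint_left.2 fun b hc hd => hcd ?_
    have hc' := (Finset.mem_filter.1 hc).2
    have hd' := (Finset.mem_filter.1 hd).2
    exact Option.some.inj (hc'.symm.trans hd')

end WaterSort

/-- reachability implies consistency with the initial configuration. -/
theorem statement_4 {B C : Type*} [Fintype B] [Fintype C] (h : ℕ) (hh : 1 ≤ h)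
    (S₀ S : B → List C) (hInit : InitConfig h S₀)
    (hreach : Relation.ReflTransGen (BallMove h) S₀ S) :
    Consistent h S₀ S := by
  have hS := reachInvariant_of_reflTransGen hInit hreach
  exact (Finset.sum_le_sum fun c _ => Mcnt_le_of_Fcnt_le hh (hS.Fcnt_le hInit c)).trans
    (sum_card_monoBins_le S)
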